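/- Suppose p satisfies Y ⊥ A | (Z,C). Then Var_p(φ_td) − Var_p(φ_bd) = Σ_{z,c} p(c)·var(Y|z,c)·D(z,c), where D(z,c) = (p(z|a⋆,c) − p(z|a°,c))²·Σ_ā p(ā|c)/p(z|ā,c) − p(z|a⋆,c)/p(a⋆|c) − p(z|a°,c)/p(a°|c). -/

import Mathlib

open Finset

noncomputable section

namespace TwoDoorPaper

/-- Indicator 1[a = b] as a real number. -/
def ind {A : Type*} [DecidableEq A] (a b : A) : ℝ := if a = b then 1 else 0

variable {C A Z Y : Type*} [Fintype C] [Fintype A] [Fintype Z] [Fintype Y]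

/-- Marginal p(c). -/
def pC (p : C → A → Z → Y → ℝ) (c : C) : ℝ := ∑ a, ∑ z, ∑ y, p c a z y

/-- Marginal p(a,c). -/
def pAC (p : C → A → Z → Y → ℝ) (a : A) (c : C) : ℝ := ∑ z, ∑ y, p c a z y

/-- Marginal p(c,a,z). -/
def pCAZ (p : C → A → Z → Y → ℝ) (c : C) (a : A) (z : Z) : ℝ := ∑ y, p c a z y

/-- Marginal p(a). -/
def pA (p : C → A → Z → Y → ℝ) (a : A) : ℝ := ∑ c, pAC p a c

/-- Marginal p(a,z). -/
def pAZ (p : C → A → Z → Y → ℝ) (a : A) (z : Z) : ℝ := ∑ c, pCAZ p c a z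

/-- Marginal p(z,c). -/
def pZC (p : C → A → Z → Y → ℝ) (z : Z) (c : C) : ℝ := ∑ a, pCAZ p c a z

/-- Conditional p(a|c). -/
def cA (p : C → A → Z → Y → ℝ) (a : A) (c : C) : ℝ := pAC p a c / pC p c

/-- Conditional p(z|a,c). -/
def cZ (p : C → A → Z → Y → ℝ) (z : Z) (a : A) (c : C) : ℝ := pCAZ p c a z / pAC p a c

/-- Conditional p(z|a). -/
def cZA (p : C → A → Z → Y → ℝ) (z : Z) (a : A) : ℝ := pAZ p a z / pA p a

/-- Conditional p(y|a,z,c). -/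
def cY (p : C → A → Z → Y → ℝ) (a : A) (z : Z) (c : C) (y : Y) : ℝ := p c a z y / pCAZ p c a z

/-- Conditional p(y|a,z). -/
def cYaz (p : C → A → Z → Y → ℝ) (a : A) (z : Z) (y : Y) : ℝ := (∑ c, p c a z y) / pAZ p a z

/-- Conditional p(y|a,c). -/
def cYac (p : C → A → Z → Y → ℝ) (a : A) (c : C) (y : Y) : ℝ := (∑ z, p c a z y) / pAC p a c

/-- Conditional p(y|z,c). -/
def cYzc (p : C → A → Z → Y → ℝ) (z : Z) (c : C) (y : Y) : ℝ := (∑ a, p c a z y) / pZC p z c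

/-- Conditional expectation E(Y|a,z,c). -/
def EYazc (p : C → A → Z → Y → ℝ) (yv : Y → ℝ) (a : A) (z : Z) (c : C) : ℝ :=
  ∑ y, yv y * cY p a z c y

/-- Conditional variance var(Y|a,z,c). -/
def VYazc (p : C → A → Z → Y → ℝ) (yv : Y → ℝ) (a : A) (z : Z) (c : C) : ℝ :=
  (∑ y, (yv y) ^ 2 * cY p a z c y) - (EYazc p yv a z c) ^ 2

/-- Conditional expectation E(Y|a,z). -/
def EYaz (p : C → A → Z → Y → ℝ) (yv : Y → ℝ) (a : A) (z : Z) : ℝ :=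
  ∑ y, yv y * cYaz p a z y

/-- Conditional variance var(Y|a,z). -/
def VYaz (p : C → A → Z → Y → ℝ) (yv : Y → ℝ) (a : A) (z : Z) : ℝ :=
  (∑ y, (yv y) ^ 2 * cYaz p a z y) - (EYaz p yv a z) ^ 2

/-- Conditional expectation E(Y|a,c). -/
def EYac (p : C → A → Z → Y → ℝ) (yv : Y → ℝ) (a : A) (c : C) : ℝ :=
  ∑ y, yv y * cYac p a c y

/-- Conditional expectation E(Y|z,c). -/
def EYzc (p : C → A → Z → Y → ℝ) (yv : Y → ℝ) (z : Z) (c : C) : ℝ :=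
  ∑ y, yv y * cYzc p z c y

/-- Conditional variance var(Y|z,c). -/
def VYzc (p : C → A → Z → Y → ℝ) (yv : Y → ℝ) (z : Z) (c : C) : ℝ :=
  (∑ y, (yv y) ^ 2 * cYzc p z c y) - (EYzc p yv z c) ^ 2

/-- var(C|a) for real-valued covariates. -/
def VCgivenA (p : C → A → Z → Y → ℝ) (cv : C → ℝ) (a : A) : ℝ :=
  (∑ c, (cv c) ^ 2 * (pAC p a c / pA p a)) - (∑ c, cv c * (pAC p a c / pA p a)) ^ 2

/-- var(Z|a) for real-valued mediators. -/
def VZgivenA (p : C → A → Z → Y → ℝ) (zv : Z → ℝ) (a : A) : ℝ :=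
  (∑ z, (zv z) ^ 2 * cZA p z a) - (∑ z, zv z * cZA p z a) ^ 2

/-- Expectation of f under p. -/
def Ep (p : C → A → Z → Y → ℝ) (f : C → A → Z → Y → ℝ) : ℝ :=
  ∑ c, ∑ a, ∑ z, ∑ y, p c a z y * f c a z y

/-- Variance of f under p. -/
def Varp (p : C → A → Z → Y → ℝ) (f : C → A → Z → Y → ℝ) : ℝ :=
  (∑ c, ∑ a, ∑ z, ∑ y, p c a z y * (f c a z y) ^ 2) - (Ep p f) ^ 2

/-- p is a strictly positive probability mass function. -/
def IsPMF (p : C → A → Z → Y → ℝ) : Prop :=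
  (∀ c a z y, 0 < p c a z y) ∧ (∑ c, ∑ a, ∑ z, ∑ y, p c a z y) = 1

/-- Y ⊥ A | (Z, C): p(y|a,z,c) does not depend on a. -/
def IndepYA (p : C → A → Z → Y → ℝ) : Prop :=
  ∀ a a' z c y, cY p a z c y = cY p a' z c y

/-- Z ⊥ C | A: p(z|a,c) = p(z|a) for all c. -/
def IndepZC (p : C → A → Z → Y → ℝ) : Prop :=
  ∀ z a c, cZ p z a c = cZA p z a

/-- θ_td. -/
def thTD (p : C → A → Z → Y → ℝ) (yv : Y → ℝ) (astar acirc : A) : ℝ :=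
  ∑ z, ∑ c, ∑ ab, EYazc p yv ab z c * (cZ p z astar c - cZ p z acirc c) * cA p ab c * pC p c

/-- The two-door efficient influence function φ_td. -/
def phiTD [DecidableEq A] (p : C → A → Z → Y → ℝ) (yv : Y → ℝ) (astar acirc : A)
    (c : C) (a : A) (z : Z) (y : Y) : ℝ :=
  (yv y - EYazc p yv a z c) * (cZ p z astar c - cZ p z acirc c) / cZ p z a c
  + ((∑ ab, EYazc p yv ab z c * cA p ab c)
      - ∑ ab, ∑ z', EYazc p yv ab z' c * cZ p z' a c * cA p ab c)
    * (ind a astar - ind a acirc) / cA p a c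
  + (∑ z', EYazc p yv a z' c * (cZ p z' astar c - cZ p z' acirc c))
  - thTD p yv astar acirc

/-- θ_bd. -/
def thBD (p : C → A → Z → Y → ℝ) (yv : Y → ℝ) (astar acirc : A) : ℝ :=
  ∑ c, pC p c * (EYac p yv astar c - EYac p yv acirc c)

/-- The back-door efficient influence function φ_bd. -/
def phiBD [DecidableEq A] (p : C → A → Z → Y → ℝ) (yv : Y → ℝ) (astar acirc : A)
    (c : C) (a : A) (_z : Z) (y : Y) : ℝ :=
  ind a astar * (yv y - EYac p yv astar c) / cA p astar c
  - ind a acirc * (yv y - EYac p yv acirc c) / cA p acirc c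
  + EYac p yv astar c - EYac p yv acirc c - thBD p yv astar acirc

/-- θ° (for the combined back-door/two-door model). -/
def thBDTD (p : C → A → Z → Y → ℝ) (yv : Y → ℝ) (astar acirc : A) : ℝ :=
  ∑ z, ∑ c, EYzc p yv z c * (cZ p z astar c - cZ p z acirc c) * pC p c

/-- The efficient influence function φ_bdtd. -/
def phiBDTD [DecidableEq A] (p : C → A → Z → Y → ℝ) (yv : Y → ℝ) (astar acirc : A)
    (c : C) (a : A) (z : Z) (y : Y) : ℝ :=
  (yv y - EYzc p yv z c) * (cZ p z astar c - cZ p z acirc c) / (∑ ab, cZ p z ab c * cA p ab c)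
  + (EYzc p yv z c - ∑ z', EYzc p yv z' c * cZ p z' a c)
    * (ind a astar - ind a acirc) / cA p a c
  + (∑ z', EYzc p yv z' c * (cZ p z' astar c - cZ p z' acirc c))
  - thBDTD p yv astar acirc

/-- ψ_fd(ă). -/
def psiFD (p : C → A → Z → Y → ℝ) (yv : Y → ℝ) (abreve : A) : ℝ :=
  ∑ z, ∑ ab, EYaz p yv ab z * pA p ab * cZA p z abreve

/-- θ_fd. -/
def thFD (p : C → A → Z → Y → ℝ) (yv : Y → ℝ) (astar acirc : A) : ℝ :=
  psiFD p yv astar - psiFD p yv acirc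

/-- The front-door efficient influence function φ_fd. -/
def phiFD [DecidableEq A] (p : C → A → Z → Y → ℝ) (yv : Y → ℝ) (astar acirc : A)
    (_c : C) (a : A) (z : Z) (y : Y) : ℝ :=
  (yv y - EYaz p yv a z) * (cZA p z astar - cZA p z acirc) / cZA p z a
  + ind a astar * ((∑ ab, EYaz p yv ab z * pA p ab) - psiFD p yv astar) / pA p astar
  - ind a acirc * ((∑ ab, EYaz p yv ab z * pA p ab) - psiFD p yv acirc) / pA p acirc
  + (∑ z', EYaz p yv a z' * (cZA p z' astar - cZA p z' acirc))
  - thFD p yv astar acirc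

/-- θ' (for the combined front-door/two-door model). -/
def thFDTD (p : C → A → Z → Y → ℝ) (yv : Y → ℝ) (astar acirc : A) : ℝ :=
  ∑ c, ∑ ab, ∑ z, EYazc p yv ab z c * (cZA p z astar - cZA p z acirc) * cA p ab c * pC p c

/-- The efficient influence function φ_fdtd. -/
def phiFDTD [DecidableEq A] (p : C → A → Z → Y → ℝ) (yv : Y → ℝ) (astar acirc : A)
    (c : C) (a : A) (z : Z) (y : Y) : ℝ :=
  (yv y - EYazc p yv a z c) * (cZA p z astar - cZA p z acirc) / cZA p z a
  + (∑ c', ((∑ ab, EYazc p yv ab z c' * cA p ab c')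
        - ∑ ab, ∑ z', EYazc p yv ab z' c' * cZA p z' a * cA p ab c') * pC p c')
    * (ind a astar - ind a acirc) / pA p a
  + (∑ z', EYazc p yv a z' c * (cZA p z' astar - cZA p z' acirc))
  - thFDTD p yv astar acirc

/-- θ'' (for the combined back/front/two-door model). -/
def thBDFDTD (p : C → A → Z → Y → ℝ) (yv : Y → ℝ) (astar acirc : A) : ℝ :=
  ∑ c, ∑ z, EYzc p yv z c * (cZA p z astar - cZA p z acirc) * pC p c

/-- The efficient influence function φ_bdfdtd. -/
def phiBDFDTD [DecidableEq A] (p : C → A → Z → Y → ℝ) (yv : Y → ℝ) (astar acirc : A)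
    (c : C) (a : A) (z : Z) (y : Y) : ℝ :=
  (yv y - EYzc p yv z c) * (cZA p z astar - cZA p z acirc) / (∑ ab, cA p ab c * cZA p z ab)
  + (∑ c', (EYzc p yv z c' - ∑ z', EYzc p yv z' c' * cZA p z' a) * pC p c')
    * (ind a astar - ind a acirc) / (∑ c', pC p c' * cA p a c')
  + (∑ z', EYzc p yv z' c * (cZA p z' astar - cZA p z' acirc))
  - thBDFDTD p yv astar acirc


lemma pCAZ_pos [Nonempty Y] {p : C → A → Z → Y → ℝ} (hp : IsPMF p) (c : C) (a : A) (z : Z) :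
    0 < pCAZ p c a z :=
  sum_pos (fun y _ => hp.1 c a z y) univ_nonempty

lemma pAC_pos [Nonempty Z] [Nonempty Y] {p : C → A → Z → Y → ℝ} (hp : IsPMF p) (a : A) (c : C) :
    0 < pAC p a c :=
  sum_pos (fun z _ => pCAZ_pos hp c a z) univ_nonempty

lemma pC_pos [Nonempty A] [Nonempty Z] [Nonempty Y] {p : C → A → Z → Y → ℝ} (hp : IsPMF p)
    (c : C) : 0 < pC p c :=
  sum_pos (fun a _ => pAC_pos hp a c) univ_nonempty

lemma sum_cA [Nonempty A] [Nonempty Z] [Nonempty Y] {p : C → A → Z → Y → ℝ} (hp : IsPMF p)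
    (c : C) : ∑ a, cA p a c = 1 := by
  simp only [cA]
  rw [← sum_div]
  exact div_self (pC_pos hp c).ne'

lemma pCAZ_mul_cY [Nonempty Y] {p : C → A → Z → Y → ℝ} (hp : IsPMF p)
    (a : A) (z : Z) (c : C) (y : Y) : pCAZ p c a z * cY p a z c y = p c a z y :=
  mul_div_cancel₀ _ (pCAZ_pos hp c a z).ne'

lemma sum_mul_yv [Nonempty Y] {p : C → A → Z → Y → ℝ} (hp : IsPMF p) (yv : Y → ℝ)
    (a : A) (z : Z) (c : C) :
    ∑ y, p c a z y * yv y = pCAZ p c a z * EYazc p yv a z c := by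
  rw [EYazc, mul_sum]
  exact sum_congr rfl fun y _ => by rw [← pCAZ_mul_cY hp a z c y]; ring

lemma sum_mul_yv_sq [Nonempty Y] {p : C → A → Z → Y → ℝ} (hp : IsPMF p) (yv : Y → ℝ)
    (a : A) (z : Z) (c : C) :
    ∑ y, p c a z y * yv y ^ 2 = pCAZ p c a z * (VYazc p yv a z c + EYazc p yv a z c ^ 2) := by
  rw [VYazc, sub_add_cancel, mul_sum]
  exact sum_congr rfl fun y _ => by rw [← pCAZ_mul_cY hp a z c y]; ring

lemma sum_mul_residual [Nonempty Y] {p : C → A → Z → Y → ℝ} (hp : IsPMF p) (yv : Y → ℝ)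
    (a : A) (z : Z) (c : C) (g k : ℝ) :
    ∑ y, p c a z y * ((yv y - EYazc p yv a z c) * g + k) = pCAZ p c a z * k := by
  have h : ∀ y, p c a z y * ((yv y - EYazc p yv a z c) * g + k)
      = p c a z y * yv y * g + p c a z y * (k - EYazc p yv a z c * g) := fun y => by ring
  simp only [h]
  rw [sum_add_distrib, ← sum_mul, ← sum_mul, sum_mul_yv hp]
  change _ + pCAZ p c a z * _ = _
  ring

lemma sum_mul_residual_sq [Nonempty Y] {p : C → A → Z → Y → ℝ} (hp : IsPMF p) (yv : Y → ℝ)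
    (a : A) (z : Z) (c : C) (g k : ℝ) :
    ∑ y, p c a z y * ((yv y - EYazc p yv a z c) * g + k) ^ 2
      = pCAZ p c a z * (VYazc p yv a z c * g ^ 2 + k ^ 2) := by
  have h : ∀ y, p c a z y * ((yv y - EYazc p yv a z c) * g + k) ^ 2
      = p c a z y * yv y ^ 2 * g ^ 2
        + p c a z y * yv y * (2 * g * (k - EYazc p yv a z c * g))
        + p c a z y * (k - EYazc p yv a z c * g) ^ 2 := fun y => by ring
  simp only [h]
  rw [sum_add_distrib, sum_add_distrib, ← sum_mul, ← sum_mul, ← sum_mul, sum_mul_yv_sq hp,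
    sum_mul_yv hp]
  change _ + pCAZ p c a z * _ = _
  ring

/-- Two functions that share their regression on `(C, A, Z)` and are affine in the residual of `Y`
have variances differing only through the squared coefficients of that residual. -/
lemma Varp_residual_sub [Nonempty Y] {p : C → A → Z → Y → ℝ} (hp : IsPMF p) (yv : Y → ℝ)
    (g h k : C → A → Z → ℝ) :
    Varp p (fun c a z y => (yv y - EYazc p yv a z c) * g c a z + k c a z)
      - Varp p (fun c a z y => (yv y - EYazc p yv a z c) * h c a z + k c a z)
      = ∑ c, ∑ a, ∑ z, pCAZ p c a z * VYazc p yv a z c * (g c a z ^ 2 - h c a z ^ 2) := by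
  simp only [Varp, Ep, sum_mul_residual hp, sum_mul_residual_sq hp]
  rw [sub_sub_sub_cancel_right]
  simp only [← sum_sub_distrib]
  refine sum_congr rfl fun c _ => sum_congr rfl fun a _ => sum_congr rfl fun z _ => ?_
  ring

lemma EYac_eq_sum [Nonempty Y] {p : C → A → Z → Y → ℝ} (hp : IsPMF p) (yv : Y → ℝ)
    (a : A) (c : C) : EYac p yv a c = ∑ z, EYazc p yv a z c * cZ p z a c := by
  have h : ∀ z, EYazc p yv a z c * cZ p z a c = (∑ y, p c a z y * yv y) / pAC p a c := fun z => by
    rw [sum_mul_yv hp, cZ]; ring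
  simp only [h]
  rw [← sum_div, sum_comm, EYac, sum_div]
  refine sum_congr rfl fun y _ => ?_
  rw [cYac, ← sum_mul]
  ring

lemma cYzc_eq_cY [Nonempty A] [Nonempty Y] {p : C → A → Z → Y → ℝ} (hp : IsPMF p)
    (hind : IndepYA p) (a : A) (z : Z) (c : C) (y : Y) : cYzc p z c y = cY p a z c y := by
  have hpos : 0 < pZC p z c := sum_pos (fun b _ => pCAZ_pos hp c b z) univ_nonempty
  rw [cYzc, div_eq_iff hpos.ne', pZC, mul_sum]
  exact sum_congr rfl fun b _ => by rw [hind a b, mul_comm, pCAZ_mul_cY hp]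

lemma EYazc_eq_EYzc [Nonempty A] [Nonempty Y] {p : C → A → Z → Y → ℝ} (hp : IsPMF p)
    (hind : IndepYA p) (yv : Y → ℝ) (a : A) (z : Z) (c : C) :
    EYazc p yv a z c = EYzc p yv z c := by
  simp only [EYazc, EYzc, cYzc_eq_cY hp hind a]

lemma VYazc_eq_VYzc [Nonempty A] [Nonempty Y] {p : C → A → Z → Y → ℝ} (hp : IsPMF p)
    (hind : IndepYA p) (yv : Y → ℝ) (a : A) (z : Z) (c : C) :
    VYazc p yv a z c = VYzc p yv z c := by
  simp only [VYazc, VYzc, EYazc_eq_EYzc hp hind, cYzc_eq_cY hp hind a]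

lemma sum_EYzc_mul_sub [Nonempty A] [Nonempty Y] {p : C → A → Z → Y → ℝ} (hp : IsPMF p)
    (hind : IndepYA p) (yv : Y → ℝ) (a b : A) (c : C) :
    ∑ z, EYzc p yv z c * (cZ p z a c - cZ p z b c) = EYac p yv a c - EYac p yv b c := by
  simp only [EYac_eq_sum hp, EYazc_eq_EYzc hp hind, mul_sub, sum_sub_distrib]

lemma thTD_eq_thBD [Nonempty A] [Nonempty Z] [Nonempty Y] {p : C → A → Z → Y → ℝ}
    (hp : IsPMF p) (hind : IndepYA p) (yv : Y → ℝ) (astar acirc : A) :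
    thTD p yv astar acirc = thBD p yv astar acirc := by
  rw [thTD, thBD, sum_comm]
  refine sum_congr rfl fun c _ => ?_
  rw [← sum_EYzc_mul_sub hp hind, mul_sum]
  refine sum_congr rfl fun z _ => ?_
  simp only [EYazc_eq_EYzc hp hind]
  rw [← sum_mul, ← mul_sum, sum_cA hp]
  ring

/-- The part of the influence functions that is a function of `(C, A, Z)`, common to the two-door
and back-door ones when `Y ⊥ A | (Z, C)`. -/
def phiRegression [DecidableEq A] (p : C → A → Z → Y → ℝ) (yv : Y → ℝ) (astar acirc : A)
    (c : C) (a : A) (z : Z) : ℝ :=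
  (EYazc p yv a z c - EYac p yv a c) * ((ind a astar - ind a acirc) / cA p a c)
    + (EYac p yv astar c - EYac p yv acirc c) - thBD p yv astar acirc

lemma phiTD_eq [Nonempty A] [Nonempty Z] [Nonempty Y] [DecidableEq A] {p : C → A → Z → Y → ℝ}
    (hp : IsPMF p) (hind : IndepYA p) (yv : Y → ℝ) (astar acirc : A) :
    phiTD p yv astar acirc = fun c a z y =>
      (yv y - EYazc p yv a z c) * ((cZ p z astar c - cZ p z acirc c) / cZ p z a c)
        + phiRegression p yv astar acirc c a z := by
  funext c a z y
  have h₁ : ∑ b, EYzc p yv z c * cA p b c = EYzc p yv z c := by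
    rw [← mul_sum, sum_cA hp, mul_one]
  have h₂ : ∑ b, ∑ z', EYzc p yv z' c * cZ p z' a c * cA p b c = EYac p yv a c := by
    simp only [← sum_mul, ← mul_sum]
    rw [sum_cA hp, mul_one, EYac_eq_sum hp]
    simp only [EYazc_eq_EYzc hp hind]
  simp only [phiTD, phiRegression, EYazc_eq_EYzc hp hind, h₁, h₂, sum_EYzc_mul_sub hp hind,
    thTD_eq_thBD hp hind]
  ring

lemma ind_mul_congr {B : Type*} [DecidableEq B] (a b : B) (f : B → ℝ) : ind a b * f b = ind a b * f a := by
  by_cases h : a = b <;> simp [ind, h]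

lemma phiBD_eq [DecidableEq A] (p : C → A → Z → Y → ℝ) (yv : Y → ℝ) (astar acirc : A) :
    phiBD p yv astar acirc = fun c a z y =>
      (yv y - EYazc p yv a z c) * ((ind a astar - ind a acirc) / cA p a c)
        + phiRegression p yv astar acirc c a z := by
  funext c a z y
  have h : ∀ b, ind a b * (yv y - EYac p yv b c) / cA p b c
      = ind a b * (yv y - EYac p yv a c) / cA p a c := fun b => by
    have := ind_mul_congr a b fun b => (yv y - EYac p yv b c) / cA p b c
    simpa only [mul_div_assoc] using this
  rw [phiBD, h, h, phiRegression]
  ring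

lemma ind_sub_ind_sq {B : Type*} [DecidableEq B] {b b' : B} (h : b ≠ b') (a : B) :
    (ind a b - ind a b') ^ 2 = ind a b + ind a b' := by
  by_cases h₁ : a = b
  · subst h₁; simp [ind, h]
  · by_cases h₂ : a = b'
    · subst h₂; simp [ind, h₁]
    · simp [ind, h₁, h₂]

lemma sum_ind_mul [DecidableEq A] (b : A) (f : A → ℝ) : ∑ a, ind a b * f a = f b := by
  simp [ind]

/-- Difference of the two-door and back-door efficiency bounds under Y ⊥ A | (Z,C). -/
theorem stmt1
    {C A Z Y : Type*} [Fintype C] [Fintype A] [Fintype Z] [Fintype Y]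
    [Nonempty C] [Nonempty A] [Nonempty Z] [Nonempty Y] [DecidableEq A]
    (p : C → A → Z → Y → ℝ) (yv : Y → ℝ) (hyv : Function.Injective yv)
    (hp : IsPMF p) (astar acirc : A) (hne : astar ≠ acirc)
    (hind : IndepYA p) :
    Varp p (phiTD p yv astar acirc) - Varp p (phiBD p yv astar acirc) =
      ∑ z, ∑ c, pC p c * VYzc p yv z c *
        ((cZ p z astar c - cZ p z acirc c) ^ 2 * (∑ ab, cA p ab c / cZ p z ab c)
          - cZ p z astar c / cA p astar c - cZ p z acirc c / cA p acirc c) := by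
  rw [phiTD_eq hp hind, phiBD_eq, Varp_residual_sub hp, sum_comm (s := (univ : Finset Z))]
  refine sum_congr rfl fun c _ => ?_
  rw [sum_comm]
  refine sum_congr rfl fun z _ => ?_
  simp only [VYazc_eq_VYzc hp hind]
  have hterm : ∀ a, pCAZ p c a z * VYzc p yv z c
      * (((cZ p z astar c - cZ p z acirc c) / cZ p z a c) ^ 2
        - ((ind a astar - ind a acirc) / cA p a c) ^ 2)
      = pC p c * VYzc p yv z c * ((cZ p z astar c - cZ p z acirc c) ^ 2
        * (cA p a c / cZ p z a c) - ind a astar * (cZ p z a c / cA p a c)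
          - ind a acirc * (cZ p z a c / cA p a c)) := fun a => by
    have h₁ := (pCAZ_pos hp c a z).ne'
    have h₂ := (pAC_pos hp a c).ne'
    have h₃ := (pC_pos hp c).ne'
    have hz : cZ p z a c ≠ 0 := div_ne_zero h₁ h₂
    have ha : cA p a c ≠ 0 := div_ne_zero h₂ h₃
    have hfac : pCAZ p c a z = pC p c * cA p a c * cZ p z a c := by
      rw [cA, cZ]; field_simp
    rw [hfac, div_pow, div_pow, ind_sub_ind_sq hne]
    field_simp
    ring
  rw [sum_congr rfl fun a _ => hterm a, ← mul_sum, sum_sub_distrib, sum_sub_distrib, ← mul_sum,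
    sum_ind_mul, sum_ind_mul]

end TwoDoorPaper
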